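/- There exist a constant c > 0 and N ∈ ℕ such that for every even n ≥ N, the perfect matching polytope PM_n ⊆ ℝ^{E(K_n)}, defined as the convex hull of the characteristic vectors of the perfect matchings of K_n, has extension complexity xc(PM_n) ≥ 2^{c·n}. -/

import Mathlib

open SimpleGraph Finset

attribute [local instance] Classical.propDecidable

/-- The edge set of the complete graph `K_n`: non-diagonal unordered pairs. -/
abbrev KEdge (n : ℕ) := {e : Sym2 (Fin n) // ¬ e.IsDiag}

/-- An edge `e` crosses the vertex set `S` if it has an endpoint in `S`
and an endpoint outside `S`. -/
def crossing {V : Type*} (S : Finset V) (e : Sym2 V) : Prop :=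
  (∃ a ∈ e, a ∈ S) ∧ (∃ a ∈ e, a ∉ S)

/-- `x(δ(S))`: the sum of the coordinates of `x` over the edges of `K_n`
crossing `S`. -/
noncomputable def cutSum {n : ℕ} (S : Finset (Fin n)) (x : KEdge n → ℝ) : ℝ :=
  ∑ e ∈ Finset.univ.filter (fun e : KEdge n => crossing S e.1), x e

/-- A comb with handle `H` and teeth `T 0, …, T (k-1)`. -/
def IsComb {V : Type*} [Fintype V] [DecidableEq V]
    (H : Finset V) {k : ℕ} (T : Fin k → Finset V) : Prop :=
  3 ≤ k ∧ Odd k ∧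
  (∀ i j, i ≠ j → Disjoint (T i) (T j)) ∧
  (∀ i, (H ∩ T i).Nonempty) ∧
  (H \ Finset.univ.biUnion T).Nonempty

/-- An `(h,t)`-uniform comb: every tooth has size `t` and meets the handle
in exactly `h` vertices. -/
def IsUniformComb {V : Type*} [Fintype V] [DecidableEq V] (h t : ℕ)
    (H : Finset V) {k : ℕ} (T : Fin k → Finset V) : Prop :=
  IsComb H T ∧ ∀ i, (T i).card = t ∧ (H ∩ T i).card = h

/-- The extension complexity of `P ⊆ ℝ^ι`: the least number of facets
(inequalities) of a polyhedron `{x : Ax ≤ b}` projecting linearly onto `P`. -/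
noncomputable def xc {ι : Type*} [Fintype ι] (P : Set (ι → ℝ)) : ℕ :=
  sInf {k | ∃ (m : ℕ) (A : Matrix (Fin k) (Fin m) ℝ) (b : Fin k → ℝ)
      (π : (Fin m → ℝ) →ₗ[ℝ] (ι → ℝ)),
      π '' {x | A.mulVec x ≤ b} = P}


/-- A perfect matching of `K_n`, given as a set of (non-loop) edges such that
every vertex belongs to exactly one of them. -/
def IsPerfectMatchingKm (n : ℕ) (M : Finset (Sym2 (Fin n))) : Prop :=
  (∀ e ∈ M, ¬ e.IsDiag) ∧ ∀ v : Fin n, ∃! e, e ∈ M ∧ v ∈ e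

/-- The perfect matching polytope of `K_n`: the convex hull of the
characteristic vectors of the perfect matchings of `K_n`. -/
noncomputable def perfectMatchingPolytope (n : ℕ) : Set (KEdge n → ℝ) :=
  convexHull ℝ {x | ∃ M : Finset (Sym2 (Fin n)), IsPerfectMatchingKm n M ∧
    x = fun e => if e.1 ∈ M then (1 : ℝ) else 0}

/-! ### The Farkas lemma -/

/-- Homogeneous Farkas lemma, for finitely many linear functionals. -/
theorem farkas_hom {E : Type*} [AddCommGroup E] [Module ℝ E] (k : ℕ) :
    ∀ (a : Fin k → E →ₗ[ℝ] ℝ) (c : E →ₗ[ℝ] ℝ),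
      (∀ x, (∀ i, a i x ≤ 0) → c x ≤ 0) →
      ∃ l : Fin k → ℝ, (∀ i, 0 ≤ l i) ∧ ∀ x, c x = ∑ i, l i * a i x := by
  induction k with
  | zero =>
    intro a c h
    refine ⟨fun _ => 0, fun i => le_refl _, fun x => ?_⟩
    have h1 := h x (fun i => i.elim0)
    have h2 := h (-x) (fun i => i.elim0)
    rw [map_neg] at h2
    simp
    linarith
  | succ k ih =>
    intro a c h
    by_cases hk : ∀ x, (∀ i : Fin k, a i.castSucc x ≤ 0) → c x ≤ 0
    · obtain ⟨l, hl, hc⟩ := ih (fun i => a i.castSucc) c hk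
      refine ⟨Fin.snoc l 0, ?_, ?_⟩
      · intro i
        refine Fin.lastCases ?_ (fun i => ?_) i
        · simp
        · simpa using hl i
      · intro x
        rw [Fin.sum_univ_castSucc]
        simpa using hc x
    · push Not at hk
      obtain ⟨x1, hx1, hcx1⟩ := hk
      have hpos : 0 < a (Fin.last k) x1 := by
        by_contra hn
        push Not at hn
        have : c x1 ≤ 0 := h x1 (fun i => by
          refine Fin.lastCases ?_ (fun i => ?_) i
          · exact hn
          · exact hx1 i)
        linarith
      set t := a (Fin.last k) x1 with ht
      set x0 := t⁻¹ • x1 with hx0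
      have ha0 : a (Fin.last k) x0 = 1 := by
        rw [hx0, map_smul, smul_eq_mul, ← ht]
        field_simp
      have hai0 : ∀ i : Fin k, a i.castSucc x0 ≤ 0 := by
        intro i
        rw [hx0, map_smul, smul_eq_mul]
        exact mul_nonpos_of_nonneg_of_nonpos (by positivity) (hx1 i)
      have hc0 : 0 < c x0 := by
        rw [hx0, map_smul, smul_eq_mul]
        positivity
      obtain ⟨l, hl, hc⟩ := ih (fun i => a i.castSucc - (a i.castSucc x0) • a (Fin.last k))
        (c - (c x0) • a (Fin.last k)) (by
          intro x hx
          have key := h (x - (a (Fin.last k) x) • x0) (by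
            intro i
            refine Fin.lastCases ?_ (fun i => ?_) i
            · simp [ha0]
            · have := hx i
              simp at this ⊢
              linarith)
          simp at key ⊢
          linarith)
      refine ⟨Fin.snoc l (c x0 - ∑ i, l i * a i.castSucc x0), ?_, ?_⟩
      · intro i
        refine Fin.lastCases ?_ (fun i => ?_) i
        · have : ∑ i, l i * a i.castSucc x0 ≤ 0 :=
            Finset.sum_nonpos (fun i _ => mul_nonpos_of_nonneg_of_nonpos (hl i) (hai0 i))
          simp
          linarith
        · simpa using hl i
      · intro x
        have := hc x
        rw [Fin.sum_univ_castSucc]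
        simp only [LinearMap.sub_apply, LinearMap.smul_apply, smul_eq_mul, mul_sub,
          Finset.sum_sub_distrib] at this
        simp only [Fin.snoc_castSucc, Fin.snoc_last]
        rw [sub_mul, Finset.sum_mul]
        have e : ∑ i, l i * (a i.castSucc x0 * a (Fin.last k) x)
            = ∑ i, l i * a i.castSucc x0 * a (Fin.last k) x :=
          Finset.sum_congr rfl (fun i _ => by ring)
        rw [e] at this
        linarith

/-- Affine Farkas lemma for a nonempty polyhedron. -/
theorem farkas_affine {m k : ℕ} (A : Matrix (Fin k) (Fin m) ℝ) (b : Fin k → ℝ)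
    (c : (Fin m → ℝ) →ₗ[ℝ] ℝ) (d : ℝ) (hne : ∃ x, A.mulVec x ≤ b)
    (h : ∀ x, A.mulVec x ≤ b → d ≤ c x) :
    ∃ (l : Fin k → ℝ) (μ : ℝ), (∀ i, 0 ≤ l i) ∧ 0 ≤ μ ∧
      ∀ x, c x - d = ∑ i, l i * (b i - A.mulVec x i) + μ := by
  obtain ⟨x0, hx0⟩ := hne
  let row : Fin k → ((Fin m → ℝ) × ℝ) →ₗ[ℝ] ℝ := fun i =>
    ((LinearMap.proj i).comp A.mulVecLin).comp (LinearMap.fst ℝ _ _)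
      - b i • LinearMap.snd ℝ _ _
  have hrow : ∀ i x t, row i (x, t) = A.mulVec x i - b i * t := by
    intro i x t
    simp [row]
  let a : Fin (k + 1) → ((Fin m → ℝ) × ℝ) →ₗ[ℝ] ℝ := Fin.snoc row (- LinearMap.snd ℝ _ _)
  obtain ⟨l, hl, hc⟩ := farkas_hom (k + 1) a
    (d • LinearMap.snd ℝ _ _ - c.comp (LinearMap.fst ℝ _ _)) (by
      rintro ⟨x, t⟩ hx
      have h1 : ∀ i, A.mulVec x i ≤ b i * t := by
        intro i
        have := hx i.castSucc
        simp only [a, Fin.snoc_castSucc, hrow] at this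
        linarith
      have h2 : 0 ≤ t := by
        have := hx (Fin.last k)
        simp [a] at this
        linarith
      simp
      rcases h2.eq_or_lt with h0 | hpos
      · subst h0
        simp
        by_contra hneg
        push Not at hneg
        have hray : ∀ s : ℝ, 0 ≤ s → d ≤ c x0 + s * c x := by
          intro s hs
          have := h (x0 + s • x) (by
            intro i
            rw [Matrix.mulVec_add, Matrix.mulVec_smul]
            have e1 := hx0 i
            have e2 := h1 i
            simp at e2 ⊢
            nlinarith)
          simpa using this
        have hs0 : 0 ≤ (|c x0 - d| + 1) / (- c x) := by
          apply div_nonneg (by positivity)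
          linarith
        have := hray _ hs0
        have e : (|c x0 - d| + 1) / (- c x) * c x = - (|c x0 - d| + 1) := by
          have : c x ≠ 0 := hneg.ne
          field_simp
        rw [e] at this
        have := le_abs_self (c x0 - d)
        linarith
      · have := h (t⁻¹ • x) (by
          intro i
          rw [Matrix.mulVec_smul]
          have e2 := h1 i
          simp
          rw [inv_mul_le_iff₀ hpos]
          linarith)
        simp at this
        rw [le_inv_mul_iff₀ hpos] at this
        linarith)
  refine ⟨fun i => l i.castSucc, l (Fin.last k), fun i => hl _, hl _, fun x => ?_⟩
  have := hc (x, 1)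
  rw [Fin.sum_univ_castSucc] at this
  simp only [a, Fin.snoc_castSucc, Fin.snoc_last, hrow] at this
  simp at this
  have e : ∑ i, l (Fin.castSucc i) * (b i - A.mulVec x i)
      = - ∑ i, l (Fin.castSucc i) * (A.mulVec x i - b i) := by
    rw [← Finset.sum_neg_distrib]
    exact Finset.sum_congr rfl (fun i _ => by ring)
  rw [e]
  linarith

/-! ### The one-function deviation bound -/

/-- (Unnormalised) marginal mass of `h` on the face `X j = b` of the cube. -/
noncomputable def margin {K : Type*} [Fintype K] [DecidableEq K]
    (h : (K → Bool) → ℝ) (j : K) (b : Bool) : ℝ :=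
  ∑ X : K → Bool, if X j = b then h X else 0

theorem exp_quad {t : ℝ} (ht : |t| ≤ 1) : Real.exp t ≤ 1 + t + t ^ 2 := by
  have := Real.abs_exp_sub_one_sub_id_le ht
  have := (abs_le.1 this).2
  linarith

theorem margin_dev {K : Type*} [Fintype K] [DecidableEq K]
    (h : (K → Bool) → ℝ) (F : ℝ) (h0 : ∀ X, 0 ≤ h X) (hF : ∀ X, h X ≤ F) (P : Finset K) :
    ∑ j ∈ P, max (margin h j false - margin h j true) 0
      ≤ 1 / 20 * ∑ j ∈ P, margin h j true
        + 100 * F * 2 ^ (Fintype.card K) * (9999 / 10000) ^ P.card := by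
  classical
  have hF0 : 0 ≤ F := (h0 (fun _ => false)).trans (hF _)
  let B : K → Prop := fun j => margin h j true < margin h j false
  let φ : K → Bool → ℝ := fun j b =>
    (if B j then (if b = true then -1 else 1) else 0) - (if b = true then 1 / 20 else 0)
  have hmax : ∀ j, max (margin h j false - margin h j true) 0 - 1 / 20 * margin h j true
      = ∑ X : K → Bool, h X * φ j (X j) := by
    intro j
    by_cases hB : B j
    · have hB' : margin h j true < margin h j false := hB
      rw [max_eq_left (by linarith)]
      unfold margin
      rw [← Finset.sum_sub_distrib, Finset.mul_sum, ← Finset.sum_sub_distrib]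
      refine Finset.sum_congr rfl (fun X _ => ?_)
      cases hX : X j <;> simp [φ, hB]
      ring
    · have hB' : ¬ margin h j true < margin h j false := hB
      rw [max_eq_right (by linarith)]
      unfold margin
      rw [zero_sub, Finset.mul_sum, ← Finset.sum_neg_distrib]
      refine Finset.sum_congr rfl (fun X _ => ?_)
      cases hX : X j <;> simp [φ, hB]
      ring
  have hsum : ∑ j ∈ P, max (margin h j false - margin h j true) 0
      - 1 / 20 * ∑ j ∈ P, margin h j true = ∑ X : K → Bool, h X * ∑ j ∈ P, φ j (X j) := by
    rw [Finset.mul_sum, ← Finset.sum_sub_distrib, Finset.sum_congr rfl (fun j _ => hmax j),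
      Finset.sum_comm]
    exact Finset.sum_congr rfl (fun X _ => by rw [Finset.mul_sum])
  have hpt : ∀ X : K → Bool, h X * ∑ j ∈ P, φ j (X j)
      ≤ 100 * F * ∏ j, (if j ∈ P then Real.exp (φ j (X j) / 100) else 1) := by
    intro X
    rw [Finset.prod_ite_mem, Finset.univ_inter, ← Real.exp_sum, ← Finset.sum_div]
    set S := ∑ j ∈ P, φ j (X j)
    have e1 : S / 100 ≤ Real.exp (S / 100) := by
      have := Real.add_one_le_exp (S / 100)
      linarith
    have e2 := Real.exp_pos (S / 100)
    rcases le_or_gt S 0 with hS | hS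
    · have := mul_nonpos_of_nonneg_of_nonpos (h0 X) hS
      have : 0 ≤ 100 * F * Real.exp (S / 100) := by positivity
      linarith
    · have := mul_le_mul_of_nonneg_right (hF X) hS.le
      have : F * S ≤ F * (100 * Real.exp (S / 100)) :=
        mul_le_mul_of_nonneg_left (by linarith) hF0
      linarith
  have hfac : ∀ j, ∑ b : Bool, (if j ∈ P then Real.exp (φ j b / 100) else 1)
      ≤ 2 * (if j ∈ P then (9999 / 10000 : ℝ) else 1) := by
    intro j
    by_cases hj : j ∈ P
    · by_cases hB : B j
      · simp [hj, hB, φ]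
        have e1 := exp_quad (t := (-1 - 20⁻¹) / 100) (by norm_num [abs_le])
        have e2 := exp_quad (t := (100 : ℝ)⁻¹) (by norm_num [abs_le])
        norm_num at e1 e2 ⊢
        linarith
      · simp [hj, hB, φ]
        have e1 := exp_quad (t := (-20⁻¹) / 100) (by norm_num [abs_le])
        norm_num at e1 ⊢
        linarith
    · simp [hj]
  have hprod : ∑ X : K → Bool, ∏ j, (if j ∈ P then Real.exp (φ j (X j) / 100) else 1)
      ≤ 2 ^ (Fintype.card K) * (9999 / 10000) ^ P.card := by
    have := Finset.prod_univ_sum (fun _ : K => (Finset.univ : Finset Bool))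
      (fun j b => if j ∈ P then Real.exp (φ j b / 100) else (1:ℝ))
    rw [Fintype.piFinset_univ] at this
    rw [← this]
    calc _ ≤ ∏ j : K, 2 * (if j ∈ P then (9999 / 10000 : ℝ) else 1) := by
          refine Finset.prod_le_prod (fun j _ => Finset.sum_nonneg (fun b _ => ?_))
            (fun j _ => hfac j)
          split_ifs <;> positivity
      _ = _ := by
          rw [Finset.prod_mul_distrib, Finset.prod_ite_mem, Finset.univ_inter,
            Finset.prod_const, Finset.prod_const, Finset.card_univ]
  have : ∑ X : K → Bool, h X * ∑ j ∈ P, φ j (X j)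
      ≤ 100 * F * (2 ^ (Fintype.card K) * (9999 / 10000) ^ P.card) := by
    calc _ ≤ ∑ X : K → Bool,
          100 * F * ∏ j, (if j ∈ P then Real.exp (φ j (X j) / 100) else 1) :=
          Finset.sum_le_sum (fun X _ => hpt X)
      _ = 100 * F * ∑ X : K → Bool, ∏ j, (if j ∈ P then Real.exp (φ j (X j) / 100) else 1) := by
          rw [Finset.mul_sum]
      _ ≤ _ := mul_le_mul_of_nonneg_left hprod (by positivity)
  linarith

/-! ### Symmetrisation over block swaps -/

theorem margin_swap {K : Type*} [Fintype K] [DecidableEq K] (h : (K → Bool) → ℝ) (o j : K)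
    (b : Bool) :
    margin (fun X => h (X ∘ Equiv.swap o j)) o b = margin h j b := by
  unfold margin
  refine Fintype.sum_equiv ((Equiv.swap o j).arrowCongr (Equiv.refl Bool)) _ _ (fun X => ?_)
  have e : ((Equiv.swap o j).arrowCongr (Equiv.refl Bool)) X = X ∘ Equiv.swap o j := by
    funext i
    simp [Equiv.arrowCongr]
  rw [e]
  simp

theorem margin_nonneg {K : Type*} [Fintype K] [DecidableEq K] (h : (K → Bool) → ℝ)
    (h0 : ∀ X, 0 ≤ h X) (j : K) (b : Bool) : 0 ≤ margin h j b := by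
  unfold margin
  refine Finset.sum_nonneg (fun X _ => ?_)
  split_ifs
  · exact h0 X
  · exact le_refl _

theorem margin_le {K : Type*} [Fintype K] [DecidableEq K] (h : (K → Bool) → ℝ) (F : ℝ)
    (h0 : ∀ X, 0 ≤ h X) (hF : ∀ X, h X ≤ F) (j : K) (b : Bool) :
    margin h j b ≤ F * 2 ^ Fintype.card K := by
  unfold margin
  calc _ ≤ ∑ X : K → Bool, F := by
        refine Finset.sum_le_sum (fun X _ => ?_)
        split_ifs
        · exact hF X
        · exact (h0 X).trans (hF X)
    _ = _ := by simp [mul_comm]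

theorem sym_bound {K G : Type*} [Fintype K] [DecidableEq K] [Group G] [Fintype G]
    (φ : G → (K → Bool) → ℝ) (F C : ℝ) (h0 : ∀ s X, 0 ≤ φ s X) (hF : ∀ s X, φ s X ≤ F)
    (P : Finset K) (o : K) (ho : o ∈ P) (τ : K → G)
    (hτ : ∀ j ∈ P, ∀ s X, φ (s * τ j) X = φ s (X ∘ Equiv.swap o j))
    (β : G → ℝ) (hβ0 : ∀ s, 0 ≤ β s) (hβC : ∀ s, β s ≤ C)
    (hβ : ∀ j ∈ P, ∀ s, β (s * τ j) = β s) :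
    ∑ s, max (margin (φ s) o false - margin (φ s) o true) 0 * β s
      ≤ 1 / 20 * ∑ s, margin (φ s) o true * β s
        + Fintype.card G * (100 * F * C * 2 ^ (Fintype.card K) * (9999 / 10000) ^ P.card) := by
  have hmar : ∀ j ∈ P, ∀ s b, margin (φ (s * τ j)) o b = margin (φ s) j b := by
    intro j hj s b
    rw [← margin_swap (φ s) o j b]
    congr 1
    funext X
    exact hτ j hj s X
  -- reindexing
  have hre : ∀ (Ψ : ℝ → ℝ → ℝ), ∀ j ∈ P,
      ∑ s, Ψ (margin (φ s) o false) (margin (φ s) o true) * β s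
        = ∑ s, Ψ (margin (φ s) j false) (margin (φ s) j true) * β s := by
    intro Ψ j hj
    rw [← Equiv.sum_comp (Equiv.mulRight (τ j))]
    refine Finset.sum_congr rfl (fun s _ => ?_)
    simp only [Equiv.coe_mulRight]
    rw [hmar j hj, hmar j hj, hβ j hj]
  have hre2 : ∀ (Ψ : ℝ → ℝ → ℝ),
      P.card * ∑ s, Ψ (margin (φ s) o false) (margin (φ s) o true) * β s
        = ∑ s, (∑ j ∈ P, Ψ (margin (φ s) j false) (margin (φ s) j true)) * β s := by
    intro Ψ
    rw [← nsmul_eq_mul, ← Finset.sum_const, Finset.sum_congr rfl (hre Ψ), Finset.sum_comm]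
    exact Finset.sum_congr rfl (fun s _ => by rw [Finset.sum_mul])
  have hP : (1 : ℝ) ≤ P.card := by
    exact_mod_cast Finset.card_pos.2 ⟨o, ho⟩
  have h1 := hre2 (fun a b => max (a - b) 0)
  have h2 := hre2 (fun _ b => b)
  set E := 100 * F * 2 ^ (Fintype.card K) * (9999 / 10000 : ℝ) ^ P.card with hE
  have hF0 : 0 ≤ F := (h0 1 (fun _ => false)).trans (hF _ _)
  have hC0 : 0 ≤ C := (hβ0 1).trans (hβC 1)
  have hE0 : 0 ≤ E := by positivity
  have h3 : ∑ s, (∑ j ∈ P, max (margin (φ s) j false - margin (φ s) j true) 0) * β s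
      ≤ ∑ s, (1 / 20 * ((∑ j ∈ P, margin (φ s) j true) * β s) + E * C) := by
    refine Finset.sum_le_sum (fun s _ => ?_)
    have := margin_dev (φ s) F (h0 s) (hF s) P
    have := mul_le_mul_of_nonneg_right this (hβ0 s)
    have := mul_le_mul_of_nonneg_left (hβC s) hE0
    rw [← hE] at *
    nlinarith
  rw [Finset.sum_add_distrib, ← Finset.mul_sum, ← h1, ← h2, Finset.sum_const, nsmul_eq_mul,
    Finset.card_univ] at h3
  have h4 : (Fintype.card G * (E * C) : ℝ) ≤ P.card * (Fintype.card G * (E * C)) := by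
    have : (0:ℝ) ≤ Fintype.card G * (E * C) := by positivity
    nlinarith
  have h5 : (Fintype.card G : ℝ) * (100 * F * C * 2 ^ (Fintype.card K) * (9999 / 10000) ^ P.card)
      = Fintype.card G * (E * C) := by
    rw [hE]; ring
  rw [h5]
  have h6 : (P.card : ℝ) * ∑ s, max (margin (φ s) o false - margin (φ s) o true) 0 * β s
      ≤ P.card * (1 / 20 * ∑ s, margin (φ s) o true * β s + Fintype.card G * (E * C)) := by
    linarith
  exact le_of_mul_le_mul_left h6 (by linarith)

/-! ### The label structure -/

/-- Labels: three special ones, `r` idle ones, and two for each block. -/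
abbrev Lab (K : Type) (r : ℕ) := (Fin 3 ⊕ Fin r) ⊕ (K × Bool)

section core
set_option linter.unusedSectionVars false
variable {K : Type} [Fintype K] [DecidableEq K] {r : ℕ}

/-- Alice's set: the three special labels and the blocks `i ∈ P` with `X i`. -/
def inU (P : Finset K) (X : K → Bool) : Lab K r → Bool
  | .inl (.inl _) => true
  | .inl (.inr _) => false
  | .inr (i, _) => decide (i ∈ P) && X i

/-- Bob's involution: identity outside blocks and on blocks `i ∈ Q` with `Y i`, and
swapping the two labels of the other blocks. -/
def rho (Q : Finset K) (Y : K → Bool) : Lab K r → Lab K r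
  | .inl l => .inl l
  | .inr (i, b) => .inr (i, if (decide (i ∈ Q) && Y i) = true then b else !b)

/-- Number of crossing edges. -/
def crn {L : Type*} [Fintype L] [DecidableEq L] (u : L → Bool) (ρ : L → L) : ℕ :=
  ∑ l : L, if u l = true ∧ (ρ l = l ∨ u (ρ l) = false) then 1 else 0

/-- swapping block `o` and block `j` -/
def blkSwap (r : ℕ) (o j : K) : Equiv.Perm (Lab K r) :=
  Equiv.sumCongr (Equiv.refl _) ((Equiv.swap o j).prodCongr (Equiv.refl _))

/-- The five special positions. -/
def pos (r : ℕ) (o : K) : Fin 5 → Lab K r :=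
  ![.inl (.inl 0), .inl (.inl 1), .inl (.inl 2), .inr (o, false), .inr (o, true)]

theorem pos_inj (o : K) : Function.Injective (pos r o) := by
  intro a b h
  fin_cases a <;> fin_cases b <;> simp [pos] at h ⊢

/-- Rotation of the five special positions. -/
noncomputable def rot (r : ℕ) (o : K) (d : Fin 5) : Equiv.Perm (Lab K r) :=
  Equiv.Perm.viaEmbedding (Equiv.addRight d) ⟨pos r o, pos_inj o⟩

theorem rot_pos (o : K) (d p : Fin 5) : rot r o d (pos r o p) = pos r o (p + d) :=
  Equiv.Perm.viaEmbedding_apply (Equiv.addRight d) ⟨pos r o, pos_inj o⟩ p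

theorem rot_symm_pos (o : K) (d p : Fin 5) : (rot r o d).symm (pos r o p) = pos r o (p - d) := by
  rw [Equiv.symm_apply_eq, rot_pos, sub_add_cancel]

theorem rot_of_notMem (o : K) (d : Fin 5) (l : Lab K r) (hl : l ∉ Set.range (pos r o)) :
    rot r o d l = l :=
  Equiv.Perm.viaEmbedding_apply_of_notMem (Equiv.addRight d) ⟨pos r o, pos_inj o⟩ l hl

theorem rot_symm_of_notMem (o : K) (d : Fin 5) (l : Lab K r) (hl : l ∉ Set.range (pos r o)) :
    (rot r o d).symm l = l := by
  rw [Equiv.symm_apply_eq, rot_of_notMem o d l hl]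

theorem crn_conj {L : Type*} [Fintype L] [DecidableEq L] (u : L → Bool) (ρ : L → L)
    (s : Equiv.Perm L) : crn (u ∘ s.symm) (s ∘ ρ ∘ s.symm) = crn u ρ := by
  unfold crn
  rw [← Equiv.sum_comp s]
  simp

theorem rho_invol (Q : Finset K) (Y : K → Bool) :
    Function.Involutive (rho Q Y : Lab K r → Lab K r) := by
  rintro (l | ⟨i, b⟩)
  · rfl
  · by_cases h : (decide (i ∈ Q) && Y i) = true
    · simp only [rho, if_pos h]
    · simp only [rho, if_neg h, Bool.not_not]

theorem inU_odd (P : Finset K) (X : K → Bool) :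
    Odd (∑ l : Lab K r, if inU P X l = true then 1 else 0) := by
  rw [Fintype.sum_sum_type, Fintype.sum_sum_type, Fintype.sum_prod_type]
  have e1 : ∑ x : Fin 3, (if inU P X (.inl (.inl x) : Lab K r) = true then 1 else 0) = 3 := by
    simp [inU]
  have e2 : ∑ x : Fin r, (if inU P X (.inl (.inr x) : Lab K r) = true then 1 else 0) = 0 := by
    simp [inU]
  have e3 : ∑ x : K, ∑ y : Bool, (if inU P X (.inr (x, y) : Lab K r) = true then 1 else 0)
      = 2 * ∑ x : K, (if inU P X (.inr (x, true) : Lab K r) = true then 1 else 0) := by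
    rw [Finset.mul_sum]
    refine Finset.sum_congr rfl (fun x _ => ?_)
    rw [Fintype.sum_bool, two_mul]
    simp [inU]
  rw [e1, e2, e3]
  exact ⟨1 + _, by ring⟩

theorem crn_base (P Q : Finset K) (o : K) (hP : o ∈ P) (hQ : o ∈ Q)
    (hPQ : ∀ i, i ∈ P → i ∈ Q → i = o) (X Y : K → Bool) :
    crn (inU P X : Lab K r → Bool) (rho Q Y) = if X o = true ∧ Y o = true then 5 else 3 := by
  have hblk : ∀ (i : K) (b : Bool), (if inU P X (.inr (i, b) : Lab K r) = true ∧
      (rho Q Y (.inr (i, b) : Lab K r) = .inr (i, b) ∨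
        inU P X (rho Q Y (.inr (i, b) : Lab K r)) = false) then 1 else 0)
      = if i = o then (if X o = true ∧ Y o = true then 1 else 0) else 0 := by
    intro i b
    by_cases hio : i = o
    · subst hio
      cases hx : X i <;> cases hy : Y i <;> simp [inU, rho, hP, hQ, hx, hy]
    · by_cases h1 : i ∈ P
      · have h2 : i ∉ Q := fun h => hio (hPQ i h1 h)
        cases hx : X i <;> simp [inU, rho, h1, h2, hio, hx]
      · simp [inU, h1, hio]
  unfold crn
  rw [Fintype.sum_sum_type, Fintype.sum_prod_type]
  simp only [hblk]
  rw [Fintype.sum_sum_type]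
  simp [inU, rho]
  split_ifs <;> rfl

end core

section core2
set_option linter.unusedSectionVars false
variable {K : Type} [Fintype K] [DecidableEq K] {r : ℕ}

/-- Swapping the last two positions. -/
def sw5 : Fin 5 → Fin 5 := ![0, 1, 2, 4, 3]

theorem inU_pos_false (P : Finset K) (o : K) (X : K → Bool) (hX : X o = false) (p : Fin 5) :
    inU P X (pos r o p) = decide (p.val < 3) := by
  fin_cases p <;> simp [pos, inU, hX]

theorem inU_pos_true (P : Finset K) (o : K) (ho : o ∈ P) (X : K → Bool) (hX : X o = true)
    (p : Fin 5) : inU P X (pos r o p) = true := by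
  fin_cases p <;> simp [pos, inU, hX, ho]

theorem rho_pos_false (Q : Finset K) (o : K) (Y : K → Bool) (hY : Y o = false) (p : Fin 5) :
    rho Q Y (pos r o p) = pos r o (sw5 p) := by
  fin_cases p <;> simp [pos, rho, hY, sw5]

theorem rho_pos_true (Q : Finset K) (o : K) (ho : o ∈ Q) (Y : K → Bool) (hY : Y o = true)
    (p : Fin 5) : rho Q Y (pos r o p) = pos r o p := by
  fin_cases p <;> simp [pos, rho, hY, ho]

theorem sum5 : ∀ i j : Fin 5, (i - j = 2 ∨ i - j = 3) →
    (∑ p : Fin 5, if decide ((p - i).val < 3) = true ∧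
      (sw5 (p - j) + j = p ∨ decide ((sw5 (p - j) + j - i).val < 3) = false) then 1 else 0) = 1 := by
  decide

theorem notMem_pos (o : K) (k : K) (b : Bool) (h : k ≠ o) :
    (.inr (k, b) : Lab K r) ∉ Set.range (pos r o) := by
  rintro ⟨p, hp⟩
  fin_cases p <;> simp [pos] at hp
  · exact h hp.1.symm
  · exact h hp.1.symm

theorem notMem_pos_cases (o : K) (l : Lab K r) (hl : l ∉ Set.range (pos r o)) :
    (∃ x, l = .inl (.inr x)) ∨ ∃ k b, k ≠ o ∧ l = .inr (k, b) := by
  rcases l with (x | x) | ⟨k, b⟩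
  · exfalso
    apply hl
    fin_cases x
    · exact ⟨0, rfl⟩
    · exact ⟨1, rfl⟩
    · exact ⟨2, rfl⟩
  · exact .inl ⟨x, rfl⟩
  · right
    refine ⟨k, b, ?_, rfl⟩
    rintro rfl
    apply hl
    cases b
    · exact ⟨3, rfl⟩
    · exact ⟨4, rfl⟩

theorem crn_rot (P Q : Finset K) (o : K)
    (hPQ : ∀ i, i ∈ P → i ∈ Q → i = o) (X Y : K → Bool) (hX : X o = false) (hY : Y o = false)
    (i j : Fin 5) (hij : i - j = 2 ∨ i - j = 3) :
    crn (inU P X ∘ (rot r o i).symm) (rot r o j ∘ rho Q Y ∘ (rot r o j).symm) = 1 := by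
  rw [← sum5 i j hij]
  unfold crn
  symm
  apply Fintype.sum_of_injective (pos r o) (pos_inj o)
  · intro l hl
    rcases notMem_pos_cases o l hl with ⟨x, rfl⟩ | ⟨k, b, hk, rfl⟩
    · rw [if_neg]
      rw [Function.comp_apply, rot_symm_of_notMem o i _ hl]
      simp [inU]
    · rw [if_neg]
      rintro ⟨h1, h2⟩
      rw [Function.comp_apply, rot_symm_of_notMem o i _ hl] at h1
      have hkP : k ∈ P := by
        simp [inU] at h1
        exact h1.1
      have hkQ : k ∉ Q := fun h => hk (hPQ k hkP h)
      have e : (rot r o j ∘ rho Q Y ∘ (rot r o j).symm) (.inr (k, b)) = .inr (k, !b) := by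
        rw [Function.comp_apply, Function.comp_apply, rot_symm_of_notMem o j _ hl]
        have : rho Q Y (.inr (k, b) : Lab K r) = .inr (k, !b) := by simp [rho, hkQ]
        rw [this, rot_of_notMem o j _ (notMem_pos o k _ hk)]
      rw [e] at h2
      rcases h2 with h2 | h2
      · simp at h2
      · rw [Function.comp_apply, rot_symm_of_notMem o i _ (notMem_pos o k _ hk)] at h2
        simp [inU] at h1 h2
        simp [h2 h1.1] at h1
  · intro p
    simp only [Function.comp_apply, rot_symm_pos, rho_pos_false Q o Y hY, rot_pos,
      inU_pos_false P o X hX, (pos_inj o).eq_iff]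

theorem inU_rot (P : Finset K) (o : K) (ho : o ∈ P) (X : K → Bool) (hX : X o = true) (d : Fin 5) :
    (inU P X ∘ (rot r o d).symm : Lab K r → Bool) = inU P X := by
  funext l
  by_cases hl : l ∈ Set.range (pos r o)
  · obtain ⟨p, rfl⟩ := hl
    rw [Function.comp_apply, rot_symm_pos, inU_pos_true P o ho X hX, inU_pos_true P o ho X hX]
  · rw [Function.comp_apply, rot_symm_of_notMem o d _ hl]

theorem rho_rot (Q : Finset K) (o : K) (ho : o ∈ Q) (Y : K → Bool) (hY : Y o = true) (d : Fin 5) :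
    (rot r o d ∘ rho Q Y ∘ (rot r o d).symm : Lab K r → Lab K r) = rho Q Y := by
  funext l
  by_cases hl : l ∈ Set.range (pos r o)
  · obtain ⟨p, rfl⟩ := hl
    rw [Function.comp_apply, Function.comp_apply, rot_symm_pos, rho_pos_true Q o ho Y hY, rot_pos,
      rho_pos_true Q o ho Y hY, sub_add_cancel]
  · rw [Function.comp_apply, Function.comp_apply, rot_symm_of_notMem o d _ hl]
    rcases notMem_pos_cases o l hl with ⟨x, rfl⟩ | ⟨k, b, hk, rfl⟩
    · exact rot_of_notMem o d _ hl
    · exact rot_of_notMem o d _ (notMem_pos o k _ hk)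

theorem swap_mem (P : Finset K) (o j : K) (ho : o ∈ P) (hj : j ∈ P) (i : K) :
    Equiv.swap o j i ∈ P ↔ i ∈ P := by
  by_cases h1 : i = o
  · subst h1; simp [ho, hj]
  · by_cases h2 : i = j
    · subst h2; simp [ho, hj]
    · rw [Equiv.swap_apply_of_ne_of_ne h1 h2]

theorem inU_blk (P : Finset K) (o j : K) (ho : o ∈ P) (hj : j ∈ P) (X : K → Bool) :
    (inU P X ∘ (blkSwap r o j).symm : Lab K r → Bool) = inU P (X ∘ Equiv.swap o j) := by
  funext l
  rcases l with (x | x) | ⟨k, b⟩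
  · rfl
  · rfl
  · have := swap_mem P o j ho hj k
    simp [inU, blkSwap, this]

theorem rho_blk (Q : Finset K) (o j : K) (ho : o ∈ Q) (hj : j ∈ Q) (Y : K → Bool) :
    (blkSwap r o j ∘ rho Q Y ∘ (blkSwap r o j).symm : Lab K r → Lab K r)
      = rho Q (Y ∘ Equiv.swap o j) := by
  funext l
  rcases l with x | ⟨k, b⟩
  · rfl
  · have := swap_mem Q o j ho hj k
    simp [rho, blkSwap, this]

/-- Masked bit is invariant under a swap of two blocks where it vanishes. -/
theorem mask_swap (P : Finset K) (X : K → Bool) (o j : K) (h1 : X o = false)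
    (h2 : j ∈ P → j = o) (k : K) :
    (decide (Equiv.swap o j k ∈ P) && X (Equiv.swap o j k)) = (decide (k ∈ P) && X k) := by
  by_cases hj : j = o
  · subst hj; simp
  · have hjP : j ∉ P := fun h => hj (h2 h)
    by_cases hk1 : k = o
    · subst hk1; simp [hjP, h1]
    · by_cases hk2 : k = j
      · subst hk2; simp [hjP, h1]
      · rw [Equiv.swap_apply_of_ne_of_ne hk1 hk2]

theorem inU_blk_inv (P : Finset K) (o j : K) (X : K → Bool) (hX : X o = false)
    (h2 : j ∈ P → j = o) :
    (inU P X ∘ (blkSwap r o j).symm : Lab K r → Bool) = inU P X := by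
  funext l
  rcases l with (x | x) | ⟨k, b⟩
  · rfl
  · rfl
  · have := mask_swap P X o j hX h2 k
    simpa [inU, blkSwap] using this

theorem rho_blk_inv (Q : Finset K) (o j : K) (Y : K → Bool) (hY : Y o = false)
    (h2 : j ∈ Q → j = o) :
    (blkSwap r o j ∘ rho Q Y ∘ (blkSwap r o j).symm : Lab K r → Lab K r) = rho Q Y := by
  funext l
  rcases l with x | ⟨k, b⟩
  · rfl
  · have := mask_swap Q Y o j hY h2 k
    simp only [rho, blkSwap, Function.comp_apply, Equiv.sumCongr_symm, Equiv.sumCongr_apply,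
      Sum.map_inr, Equiv.prodCongr_symm, Equiv.prodCongr_apply, Prod.map_apply, Equiv.symm_swap,
      Equiv.refl_symm, Equiv.refl_apply, this]
    simp

end core2

section core3
set_option linter.unusedSectionVars false

theorem card5 : ∀ S : Finset (Fin 5), (∀ i ∈ S, ∀ j ∈ S, i - j ≠ 2 ∧ i - j ≠ 3) → S.card ≤ 2 := by
  decide

theorem five_sum (a b : Fin 5 → ℝ) (ha : ∀ i, 0 ≤ a i) (hb : ∀ i, 0 ≤ b i) (α β : ℝ)
    (hα : 0 ≤ α) (hβ : 0 ≤ β) (hz : ∀ i j, (i - j = 2 ∨ i - j = 3) → a i * b j = 0) :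
    ∑ i, a i * b i ≤ 2 * (α * β) +
      ∑ i, (max (a i - α) 0 * b i + a i * max (b i - β) 0) := by
  classical
  let S : Finset (Fin 5) := Finset.univ.filter (fun i => a i * b i ≠ 0)
  have hS : S.card ≤ 2 := by
    apply card5
    intro i hi j hj
    simp only [S, Finset.mem_filter, Finset.mem_univ, true_and, mul_ne_zero_iff] at hi hj
    have hn : ¬ (i - j = 2 ∨ i - j = 3) := by
      intro h
      have := hz i j h
      rw [mul_eq_zero] at this
      tauto
    tauto
  have hpt : ∀ i, a i * b i ≤ (if i ∈ S then α * β else 0) +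
      (max (a i - α) 0 * b i + a i * max (b i - β) 0) := by
    intro i
    have e1 := le_max_left (a i - α) 0
    have e2 := le_max_right (a i - α) 0
    have e3 := le_max_left (b i - β) 0
    have e4 := le_max_right (b i - β) 0
    by_cases hi : i ∈ S
    · rw [if_pos hi]
      rcases le_or_gt (a i) α with h1 | h1
      · have f1 := mul_nonneg e2 (hb i)
        have f2 := mul_le_mul_of_nonneg_left e3 (ha i)
        have f3 := mul_le_mul_of_nonneg_right h1 hβ
        nlinarith
      · have f1 := mul_le_mul_of_nonneg_right e1 (hb i)
        have f2 := mul_le_mul_of_nonneg_left e3 hα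
        have f3 := mul_le_mul_of_nonneg_right h1.le e4
        nlinarith
    · rw [if_neg hi]
      have : a i * b i = 0 := by
        by_contra h
        exact hi (by simp [S]; simpa using h)
      rw [this]
      have := mul_nonneg e2 (hb i)
      have := mul_nonneg (ha i) e4
      linarith
  calc _ ≤ ∑ i, ((if i ∈ S then α * β else 0) +
      (max (a i - α) 0 * b i + a i * max (b i - β) 0)) := Finset.sum_le_sum (fun i _ => hpt i)
    _ = S.card * (α * β) + ∑ i, (max (a i - α) 0 * b i + a i * max (b i - β) 0) := by
        rw [Finset.sum_add_distrib]
        congr 1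
        rw [Finset.sum_ite_mem, Finset.univ_inter, Finset.sum_const, nsmul_eq_mul]
    _ ≤ _ := by
        have : (S.card : ℝ) ≤ 2 := by exact_mod_cast hS
        have := mul_le_mul_of_nonneg_right this (mul_nonneg hα hβ)
        linarith

variable {K : Type} [Fintype K] [DecidableEq K] {r : ℕ}

/-- Alice's function in the frame `s`. -/
def fA (P : Finset K) (f : (Lab K r → Bool) → ℝ) (s : Equiv.Perm (Lab K r)) (X : K → Bool) : ℝ :=
  f (inU P X ∘ s.symm)

/-- Bob's function in the frame `s`. -/
def fB (Q : Finset K) (g : (Lab K r → Lab K r) → ℝ) (s : Equiv.Perm (Lab K r)) (Y : K → Bool) : ℝ :=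
  g (s ∘ rho Q Y ∘ s.symm)

theorem margin_congr {h h' : (K → Bool) → ℝ} (j : K) (b : Bool)
    (H : ∀ X, X j = b → h X = h' X) : margin h j b = margin h' j b := by
  unfold margin
  refine Finset.sum_congr rfl (fun X _ => ?_)
  split_ifs with hX
  · exact H X hX
  · rfl

/-- A set is odd. -/
def OddSet {L : Type*} [Fintype L] (u : L → Bool) : Prop :=
  Odd (∑ l : L, if u l = true then 1 else 0)

theorem oddSet_frame (P : Finset K) (X : K → Bool) (s : Equiv.Perm (Lab K r)) :
    OddSet (inU P X ∘ s.symm) := by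
  unfold OddSet
  rw [← Equiv.sum_comp s]
  simpa using inU_odd P X

theorem invol_frame (Q : Finset K) (Y : K → Bool) (s : Equiv.Perm (Lab K r)) :
    Function.Involutive (s ∘ rho Q Y ∘ s.symm) := by
  intro l
  simp [rho_invol Q Y _]

theorem rank_one (P Q : Finset K) (o : K) (hP : o ∈ P) (hQ : o ∈ Q)
    (hPQ : ∀ i, i ∈ P → i ∈ Q → i = o) (p : ℕ) (hPc : P.card = p) (hQc : Q.card = p)
    (f : (Lab K r → Bool) → ℝ) (g : (Lab K r → Lab K r) → ℝ) (F G : ℝ)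
    (hf0 : ∀ u, 0 ≤ f u) (hfF : ∀ u, f u ≤ F) (hg0 : ∀ ρ, 0 ≤ g ρ) (hgG : ∀ ρ, g ρ ≤ G)
    (hz : ∀ u ρ, OddSet u → Function.Involutive ρ → crn u ρ = 1 → f u * g ρ = 0) :
    ∑ s, margin (fA P f s) o false * margin (fB Q g s) o false
      ≤ 2 / 5 * ∑ s, margin (fA P f s) o true * margin (fB Q g s) o true
        + 1 / 20 * ∑ s, margin (fA P f s) o true * margin (fB Q g s) o false
        + 1 / 20 * ∑ s, margin (fA P f s) o false * margin (fB Q g s) o true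
        + 2 * (Fintype.card (Equiv.Perm (Lab K r)) *
          (100 * (F * G) * (2 ^ (Fintype.card K)) ^ 2 * (9999 / 10000) ^ p)) := by
  have hA0 : ∀ s X, 0 ≤ fA P f s X := fun s X => hf0 _
  have hAF : ∀ s X, fA P f s X ≤ F := fun s X => hfF _
  have hB0 : ∀ s X, 0 ≤ fB Q g s X := fun s X => hg0 _
  have hBG : ∀ s X, fB Q g s X ≤ G := fun s X => hgG _
  have mA0 : ∀ s b, 0 ≤ margin (fA P f s) o b := fun s b => margin_nonneg _ (hA0 s) o b
  have mB0 : ∀ s b, 0 ≤ margin (fB Q g s) o b := fun s b => margin_nonneg _ (hB0 s) o b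
  have rotA : ∀ s d, margin (fA P f (s * rot r o d)) o true = margin (fA P f s) o true := by
    intro s d
    refine margin_congr o true (fun X hX => ?_)
    have : inU P X ∘ (s * rot r o d).symm = (inU P X ∘ (rot r o d).symm) ∘ s.symm := rfl
    unfold fA
    rw [this, inU_rot P o hP X hX]
  have rotB : ∀ s d, margin (fB Q g (s * rot r o d)) o true = margin (fB Q g s) o true := by
    intro s d
    refine margin_congr o true (fun Y hY => ?_)
    have : (s * rot r o d) ∘ rho Q Y ∘ (s * rot r o d).symm
      = s ∘ (rot r o d ∘ rho Q Y ∘ (rot r o d).symm) ∘ s.symm := rfl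
    unfold fB
    rw [this, rho_rot Q o hQ Y hY]
  have zero : ∀ s i j, (i - j = 2 ∨ i - j = 3) →
      margin (fA P f (s * rot r o i)) o false * margin (fB Q g (s * rot r o j)) o false = 0 := by
    intro s i j hij
    unfold margin
    rw [Finset.sum_mul_sum]
    refine Finset.sum_eq_zero (fun X _ => Finset.sum_eq_zero (fun Y _ => ?_))
    split_ifs with hX hY
    · refine hz _ _ (oddSet_frame P X _) (invol_frame Q Y _) ?_
      have e1 : inU P X ∘ (s * rot r o i).symm = (inU P X ∘ (rot r o i).symm) ∘ s.symm := rfl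
      have e2 : (s * rot r o j) ∘ rho Q Y ∘ (s * rot r o j).symm
        = s ∘ (rot r o j ∘ rho Q Y ∘ (rot r o j).symm) ∘ s.symm := rfl
      rw [e1, e2, crn_conj]
      exact crn_rot P Q o hPQ X Y hX hY i j hij
    · simp
    · simp
    · simp
  have hfive := fun s => five_sum (fun i => margin (fA P f (s * rot r o i)) o false)
    (fun i => margin (fB Q g (s * rot r o i)) o false) (fun i => mA0 _ _) (fun i => mB0 _ _)
    (margin (fA P f s) o true) (margin (fB Q g s) o true) (mA0 _ _) (mB0 _ _) (zero s)
  have hre : ∀ Φ : Equiv.Perm (Lab K r) → ℝ, ∑ s, ∑ i : Fin 5, Φ (s * rot r o i) = 5 * ∑ s, Φ s := by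
    intro Φ
    rw [Finset.sum_comm]
    have : ∀ i : Fin 5, ∑ s, Φ (s * rot r o i) = ∑ s, Φ s := fun i =>
      Equiv.sum_comp (Equiv.mulRight (rot r o i)) Φ
    simp [this]
  have h1 := Finset.sum_le_sum (fun s (_ : s ∈ (Finset.univ : Finset (Equiv.Perm (Lab K r)))) => hfive s)
  rw [hre (fun s => margin (fA P f s) o false * margin (fB Q g s) o false),
    Finset.sum_add_distrib, ← Finset.mul_sum] at h1
  have h2 : ∑ s, ∑ i : Fin 5, (max (margin (fA P f (s * rot r o i)) o false
        - margin (fA P f s) o true) 0 * margin (fB Q g (s * rot r o i)) o false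
      + margin (fA P f (s * rot r o i)) o false * max (margin (fB Q g (s * rot r o i)) o false
        - margin (fB Q g s) o true) 0)
      = 5 * ∑ s, (max (margin (fA P f s) o false
        - margin (fA P f s) o true) 0 * margin (fB Q g s) o false
      + margin (fA P f s) o false * max (margin (fB Q g s) o false
        - margin (fB Q g s) o true) 0) := by
    rw [← hre]
    refine Finset.sum_congr rfl (fun s _ => Finset.sum_congr rfl (fun i _ => ?_))
    rw [rotA, rotB]
  rw [h2, Finset.sum_add_distrib] at h1
  have hF0 : 0 ≤ F := (hf0 (fun _ => false)).trans (hfF _)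
  have hG0 : 0 ≤ G := (hg0 id).trans (hgG _)
  have sA := sym_bound (fA P f) F (G * 2 ^ Fintype.card K) hA0 hAF P o hP (blkSwap r o)
    (by
      intro j hj s X
      have : inU P X ∘ (s * blkSwap r o j).symm = (inU P X ∘ (blkSwap r o j).symm) ∘ s.symm := rfl
      unfold fA
      rw [this, inU_blk P o j hP hj X])
    (fun s => margin (fB Q g s) o false) (fun s => mB0 _ _)
    (fun s => margin_le _ G (hB0 s) (hBG s) o false)
    (by
      intro j hj s
      refine margin_congr o false (fun Y hY => ?_)
      have : (s * blkSwap r o j) ∘ rho Q Y ∘ (s * blkSwap r o j).symm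
        = s ∘ (blkSwap r o j ∘ rho Q Y ∘ (blkSwap r o j).symm) ∘ s.symm := rfl
      unfold fB
      rw [this, rho_blk_inv Q o j Y hY (fun h => hPQ j hj h)])
  have sB := sym_bound (fB Q g) G (F * 2 ^ Fintype.card K) hB0 hBG Q o hQ (blkSwap r o)
    (by
      intro j hj s Y
      have : (s * blkSwap r o j) ∘ rho Q Y ∘ (s * blkSwap r o j).symm
        = s ∘ (blkSwap r o j ∘ rho Q Y ∘ (blkSwap r o j).symm) ∘ s.symm := rfl
      unfold fB
      rw [this, rho_blk Q o j hQ hj Y])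
    (fun s => margin (fA P f s) o false) (fun s => mA0 _ _)
    (fun s => margin_le _ F (hA0 s) (hAF s) o false)
    (by
      intro j hj s
      refine margin_congr o false (fun X hX => ?_)
      have : inU P X ∘ (s * blkSwap r o j).symm = (inU P X ∘ (blkSwap r o j).symm) ∘ s.symm := rfl
      unfold fA
      rw [this, inU_blk_inv P o j X hX (fun h => hPQ j h hj)])
  rw [hPc] at sA
  rw [hQc] at sB
  simp only [mul_comm (margin (fB Q g _) o true)] at sB
  simp only [mul_comm (max (margin (fB Q g _) o false - margin (fB Q g _) o true) 0)] at sB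
  have e1 : 100 * F * (G * 2 ^ Fintype.card K) * 2 ^ Fintype.card K * (9999 / 10000 : ℝ) ^ p
      = 100 * (F * G) * (2 ^ (Fintype.card K)) ^ 2 * (9999 / 10000) ^ p := by ring
  have e2 : 100 * G * (F * 2 ^ Fintype.card K) * 2 ^ Fintype.card K * (9999 / 10000 : ℝ) ^ p
      = 100 * (F * G) * (2 ^ (Fintype.card K)) ^ 2 * (9999 / 10000) ^ p := by ring
  rw [e1] at sA
  rw [e2] at sB
  linarith

theorem margin_one (o : K) (b : Bool) :
    margin (fun _ : K → Bool => (1 : ℝ)) o b = 2 ^ Fintype.card K / 2 := by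
  have h1 : margin (fun _ : K → Bool => (1 : ℝ)) o true = margin (fun _ => 1) o false := by
    unfold margin
    have hinv : Function.Involutive (fun X : K → Bool => Function.update X o (!X o)) := by
      intro X
      simp
    refine Fintype.sum_equiv hinv.toPerm _ _ (fun X => ?_)
    simp [Function.Involutive.toPerm]
  have h2 : margin (fun _ : K → Bool => (1 : ℝ)) o true + margin (fun _ => 1) o false
      = 2 ^ Fintype.card K := by
    unfold margin
    rw [← Finset.sum_add_distrib]
    have : ∀ X : K → Bool, ((if X o = true then (1:ℝ) else 0) + if X o = false then 1 else 0) = 1 := by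
      intro X
      cases X o <;> simp
    simp [this]
  cases b <;> linarith

theorem margin_total (P Q : Finset K) (o : K) (hP : o ∈ P) (hQ : o ∈ Q)
    (hPQ : ∀ i, i ∈ P → i ∈ Q → i = o) (N : ℕ)
    (f : Fin N → (Lab K r → Bool) → ℝ) (g : Fin N → (Lab K r → Lab K r) → ℝ)
    (hfac : ∀ u ρ, OddSet u → Function.Involutive ρ → ∑ t, f t u * g t ρ = (crn u ρ : ℝ) - 1)
    (a b : Bool) :
    ∑ t, ∑ s, margin (fA P (f t) s) o a * margin (fB Q (g t) s) o b
      = Fintype.card (Equiv.Perm (Lab K r)) * (2 ^ Fintype.card K / 2) ^ 2 *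
        (if a = true ∧ b = true then 4 else 2) := by
  rw [Finset.sum_comm]
  have : ∀ s : Equiv.Perm (Lab K r),
      ∑ t, margin (fA P (f t) s) o a * margin (fB Q (g t) s) o b
        = (2 ^ Fintype.card K / 2) ^ 2 * (if a = true ∧ b = true then 4 else 2) := by
    intro s
    have h1 : ∀ X Y : K → Bool, X o = a → Y o = b →
        ∑ t, fA P (f t) s X * fB Q (g t) s Y = (if a = true ∧ b = true then 4 else 2) := by
      intro X Y hX hY
      unfold fA fB
      rw [hfac _ _ (oddSet_frame P X s) (invol_frame Q Y s), crn_conj, crn_base P Q o hP hQ hPQ,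
        hX, hY]
      split_ifs <;> norm_num
    calc _ = ∑ t, ∑ X : K → Bool, ∑ Y : K → Bool, (if X o = a then fA P (f t) s X else 0)
          * (if Y o = b then fB Q (g t) s Y else 0) := by
          refine Finset.sum_congr rfl (fun t _ => ?_)
          unfold margin
          rw [Finset.sum_mul_sum]
      _ = ∑ X : K → Bool, ∑ Y : K → Bool, ∑ t, (if X o = a then fA P (f t) s X else 0)
          * (if Y o = b then fB Q (g t) s Y else 0) := by
          rw [Finset.sum_comm]
          exact Finset.sum_congr rfl (fun X _ => Finset.sum_comm)
      _ = ∑ X : K → Bool, ∑ Y : K → Bool, ((if X o = a then (1:ℝ) else 0)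
          * (if Y o = b then (1:ℝ) else 0)) * (if a = true ∧ b = true then 4 else 2) := by
          refine Finset.sum_congr rfl (fun X _ => Finset.sum_congr rfl (fun Y _ => ?_))
          by_cases hX : X o = a
          · by_cases hY : Y o = b
            · simp only [if_pos hX, if_pos hY]
              rw [h1 X Y hX hY]
              ring
            · simp [hY]
          · simp [hX]
      _ = (margin (fun _ : K → Bool => (1 : ℝ)) o a * margin (fun _ : K → Bool => (1 : ℝ)) o b)
          * (if a = true ∧ b = true then 4 else 2) := by
          unfold margin
          rw [Finset.sum_mul_sum, Finset.sum_mul]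
          exact Finset.sum_congr rfl (fun X _ => by rw [Finset.sum_mul])
      _ = _ := by
          rw [margin_one, margin_one]
          ring
  simp only [this]
  rw [Finset.sum_const, nsmul_eq_mul, Finset.card_univ]
  ring

theorem core_bound (P Q : Finset K) (o : K) (hP : o ∈ P) (hQ : o ∈ Q)
    (hPQ : ∀ i, i ∈ P → i ∈ Q → i = o) (p : ℕ) (hPc : P.card = p) (hQc : Q.card = p)
    (N : ℕ) (D : ℝ)
    (f : Fin N → (Lab K r → Bool) → ℝ) (g : Fin N → (Lab K r → Lab K r) → ℝ)
    (hf0 : ∀ t u, 0 ≤ f t u) (hg0 : ∀ t ρ, 0 ≤ g t ρ)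
    (hD : ∀ t u ρ, f t u * g t ρ ≤ D)
    (hfac : ∀ u ρ, OddSet u → Function.Involutive ρ → ∑ t, f t u * g t ρ = (crn u ρ : ℝ) - 1) :
    1 ≤ 4000 * N * D * (9999 / 10000) ^ p := by
  have hrank : ∀ t, ∑ s, margin (fA P (f t) s) o false * margin (fB Q (g t) s) o false
      ≤ 2 / 5 * ∑ s, margin (fA P (f t) s) o true * margin (fB Q (g t) s) o true
        + 1 / 20 * ∑ s, margin (fA P (f t) s) o true * margin (fB Q (g t) s) o false
        + 1 / 20 * ∑ s, margin (fA P (f t) s) o false * margin (fB Q (g t) s) o true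
        + 2 * (Fintype.card (Equiv.Perm (Lab K r)) *
          (100 * D * (2 ^ (Fintype.card K)) ^ 2 * (9999 / 10000) ^ p)) := by
    intro t
    obtain ⟨u0, hu0⟩ := Finite.exists_max (f t)
    obtain ⟨ρ0, hρ0⟩ := Finite.exists_max (g t)
    have h := rank_one P Q o hP hQ hPQ p hPc hQc (f t) (g t) (f t u0) (g t ρ0)
      (hf0 t) hu0 (hg0 t) hρ0 (by
        intro u ρ hu hρ hc
        have h1 := hfac u ρ hu hρ
        rw [hc] at h1
        norm_num at h1
        exact (Finset.sum_eq_zero_iff_of_nonneg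
          (fun t _ => mul_nonneg (hf0 t u) (hg0 t ρ))).1 h1 t (Finset.mem_univ t))
    have h' : (Fintype.card (Equiv.Perm (Lab K r)) *
          (100 * (f t u0 * g t ρ0) * (2 ^ (Fintype.card K)) ^ 2 * (9999 / 10000) ^ p) : ℝ)
        ≤ Fintype.card (Equiv.Perm (Lab K r)) *
          (100 * D * (2 ^ (Fintype.card K)) ^ 2 * (9999 / 10000) ^ p) := by
      have := hD t u0 ρ0
      gcongr
    exact h.trans (by
      have := mul_le_mul_of_nonneg_left h' (by norm_num : (0:ℝ) ≤ 2)
      exact add_le_add (le_refl _) this)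
  have hs := Finset.sum_le_sum (fun t (_ : t ∈ (Finset.univ : Finset (Fin N))) => hrank t)
  rw [Finset.sum_add_distrib, Finset.sum_add_distrib, Finset.sum_add_distrib, ← Finset.mul_sum,
    ← Finset.mul_sum, ← Finset.mul_sum, margin_total P Q o hP hQ hPQ N f g hfac,
    margin_total P Q o hP hQ hPQ N f g hfac, margin_total P Q o hP hQ hPQ N f g hfac,
    margin_total P Q o hP hQ hPQ N f g hfac, Finset.sum_const, Finset.card_univ,
    Fintype.card_fin, nsmul_eq_mul] at hs
  simp only [Bool.false_eq_true, false_and, and_false, if_false, and_self, if_true] at hs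
  have hc : (0:ℝ) < Fintype.card (Equiv.Perm (Lab K r)) * (2 ^ Fintype.card K) ^ 2 := by
    have : 0 < Fintype.card (Equiv.Perm (Lab K r)) := Fintype.card_pos
    positivity
  set c := (Fintype.card (Equiv.Perm (Lab K r)) : ℝ) * (2 ^ Fintype.card K) ^ 2 with hcdef
  have e1 : (Fintype.card (Equiv.Perm (Lab K r)) : ℝ) * (2 ^ Fintype.card K / 2) ^ 2 = c / 4 := by
    rw [hcdef]; ring
  have e2 : (N : ℝ) * (2 * (Fintype.card (Equiv.Perm (Lab K r)) *
          (100 * D * (2 ^ (Fintype.card K)) ^ 2 * (9999 / 10000) ^ p)))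
      = c * (200 * (N * D * (9999 / 10000) ^ p)) := by
    rw [hcdef]; ring
  rw [e1, e2] at hs
  have : c * (1 / 20) ≤ c * (200 * (N * D * (9999 / 10000) ^ p)) := by linarith
  have := le_of_mul_le_mul_left this hc
  linarith

end core3

/-! ### Perfect matchings and involutions -/

/-- The matching of a fixed-point-free involution. -/
noncomputable def invMatch {n : ℕ} (τ : Fin n → Fin n) : Finset (Sym2 (Fin n)) :=
  Finset.univ.image (fun v => s(v, τ v))

/-- Characteristic vector. -/
noncomputable def chi {n : ℕ} (M : Finset (Sym2 (Fin n))) : KEdge n → ℝ :=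
  fun e => if e.1 ∈ M then (1 : ℝ) else 0

theorem invMatch_pm {n : ℕ} (τ : Fin n → Fin n) (hτ : Function.Involutive τ)
    (hne : ∀ v, τ v ≠ v) : IsPerfectMatchingKm n (invMatch τ) := by
  refine ⟨?_, ?_⟩
  · intro e he
    obtain ⟨v, -, rfl⟩ := Finset.mem_image.1 he
    rw [Sym2.mk_isDiag_iff]
    exact fun h => hne v h.symm
  · intro v
    refine ⟨s(v, τ v), ⟨Finset.mem_image_of_mem _ (Finset.mem_univ v), Sym2.mem_mk_left _ _⟩, ?_⟩
    rintro e ⟨he, hv⟩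
    obtain ⟨w, -, rfl⟩ := Finset.mem_image.1 he
    rcases Sym2.mem_iff.1 hv with h | h
    · rw [h]
    · rw [h, hτ w, Sym2.eq_swap]

theorem pm_exists_inv {n : ℕ} (M : Finset (Sym2 (Fin n))) (hM : IsPerfectMatchingKm n M) :
    ∃ τ : Fin n → Fin n, Function.Involutive τ ∧ (∀ v, τ v ≠ v) ∧ M = invMatch τ := by
  obtain ⟨hd, hu⟩ := hM
  choose E hE hEu using hu
  have hex : ∀ v, ∃ w, E v = s(v, w) := fun v => by
    obtain ⟨w, hw⟩ := Sym2.mem_iff_exists.1 (hE v).2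
    exact ⟨w, hw⟩
  choose τ hτ using hex
  have key : ∀ v, E (τ v) = E v := fun v =>
    (hEu (τ v) (E v) ⟨(hE v).1, by rw [hτ v]; exact Sym2.mem_mk_right _ _⟩).symm
  have hne : ∀ v, τ v ≠ v := fun v h => by
    have := hd _ (hE v).1
    rw [hτ v, Sym2.mk_isDiag_iff] at this
    exact this h.symm
  refine ⟨τ, ?_, hne, ?_⟩
  · intro v
    have h1 := key v
    rw [hτ (τ v), hτ v, Sym2.eq_iff] at h1
    rcases h1 with h | h
    · exact absurd h.1 (hne v)
    · exact h.2
  · ext e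
    unfold invMatch
    rw [Finset.mem_image]
    constructor
    · intro he
      induction e with
      | h a b =>
        refine ⟨a, Finset.mem_univ _, ?_⟩
        rw [← hτ a]
        exact (hEu a _ ⟨he, Sym2.mem_mk_left _ _⟩).symm
    · rintro ⟨v, -, rfl⟩
      rw [← hτ v]
      exact (hE v).1

theorem cutSum_inv {n : ℕ} (τ : Fin n → Fin n) (hτ : Function.Involutive τ)
    (hne : ∀ v, τ v ≠ v) (U : Finset (Fin n)) :
    cutSum U (chi (invMatch τ)) = ((U.filter (fun v => τ v ∉ U)).card : ℝ) := by
  unfold cutSum chi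
  rw [Finset.sum_boole]
  congr 1
  symm
  refine Finset.card_bij (fun v _ => (⟨s(v, τ v), fun h => hne v
    (Sym2.mk_isDiag_iff.1 h).symm⟩ : KEdge n)) ?_ ?_ ?_
  · intro v hv
    rw [Finset.mem_filter] at hv
    simp only [Finset.mem_filter, Finset.mem_univ, true_and]
    exact ⟨⟨⟨v, Sym2.mem_mk_left _ _, hv.1⟩, ⟨τ v, Sym2.mem_mk_right _ _, hv.2⟩⟩,
      Finset.mem_image_of_mem _ (Finset.mem_univ v)⟩
  · intro v hv w hw h
    rw [Finset.mem_filter] at hv hw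
    rw [Subtype.mk.injEq, Sym2.eq_iff] at h
    rcases h with h | h
    · exact h.1
    · exact absurd (h.1 ▸ hv.1) hw.2
  · rintro ⟨e, he⟩ h
    simp only [Finset.mem_filter, Finset.mem_univ, true_and] at h
    obtain ⟨⟨⟨a, ha, haU⟩, ⟨b, hb, hbU⟩⟩, hm⟩ := h
    obtain ⟨v, -, rfl⟩ := Finset.mem_image.1 hm
    rw [Sym2.mem_iff] at ha hb
    rcases ha with rfl | rfl
    · rcases hb with rfl | rfl
      · exact absurd haU hbU
      · exact ⟨a, Finset.mem_filter.2 ⟨haU, hbU⟩, rfl⟩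
    · rcases hb with rfl | rfl
      · refine ⟨τ b, Finset.mem_filter.2 ⟨haU, by rwa [hτ b]⟩, ?_⟩
        apply Subtype.ext
        show s(τ b, τ (τ b)) = s(b, τ b)
        rw [hτ b, Sym2.eq_swap]
      · exact absurd haU hbU

theorem cutSum_pm_ge {n : ℕ} (M : Finset (Sym2 (Fin n))) (hM : IsPerfectMatchingKm n M)
    (U : Finset (Fin n)) (hU : Odd U.card) : 1 ≤ cutSum U (chi M) := by
  obtain ⟨τ, hτ, hne, rfl⟩ := pm_exists_inv M hM
  rw [cutSum_inv τ hτ hne U]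
  rw [Nat.one_le_cast, Nat.one_le_iff_ne_zero]
  intro h0
  rw [Finset.card_eq_zero, Finset.filter_eq_empty_iff] at h0
  have hs : ∑ v ∈ U, (1 : ZMod 2) = 0 := by
    refine Finset.sum_involution (fun v _ => τ v) ?_ ?_ ?_ ?_
    · intro v _; decide
    · intro v _ _; exact hne v
    · intro v hv
      exact not_not.1 (h0 hv)
    · intro v _; exact hτ v
  rw [Finset.sum_const, nsmul_eq_mul, mul_one, ZMod.natCast_eq_zero_iff_even] at hs
  exact Nat.not_even_iff_odd.2 hU hs

/-- `cutSum` as a linear map. -/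
noncomputable def cutLin {n : ℕ} (S : Finset (Fin n)) : (KEdge n → ℝ) →ₗ[ℝ] ℝ where
  toFun := cutSum S
  map_add' x y := by simp [cutSum, Finset.sum_add_distrib]
  map_smul' c x := by simp [cutSum, Finset.mul_sum]

theorem polytope_eq (n : ℕ) : perfectMatchingPolytope n =
    convexHull ℝ {x | ∃ M : Finset (Sym2 (Fin n)), IsPerfectMatchingKm n M ∧ x = chi M} := rfl

theorem cutLin_ge {n : ℕ} (U : Finset (Fin n)) (hU : Odd U.card) (x : KEdge n → ℝ)
    (hx : x ∈ perfectMatchingPolytope n) : 1 ≤ cutLin U x := by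
  have hsub : perfectMatchingPolytope n ⊆ {x | 1 ≤ cutLin U x} := by
    rw [polytope_eq]
    refine convexHull_min ?_ (convex_halfSpace_ge (cutLin U).isLinear 1)
    rintro _ ⟨M, hM, rfl⟩
    exact cutSum_pm_ge M hM U hU
  exact hsub hx

/-! ### The extension complexity is attained -/

theorem xc_nonempty {ι : Type*} [Fintype ι] (S : Set (ι → ℝ)) (hS : S.Finite) :
    ∃ (k m : ℕ) (A : Matrix (Fin k) (Fin m) ℝ) (b : Fin k → ℝ)
      (π : (Fin m → ℝ) →ₗ[ℝ] (ι → ℝ)), π '' {x | A.mulVec x ≤ b} = convexHull ℝ S := by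
  classical
  obtain ⟨m, z, hz⟩ : ∃ (m : ℕ) (z : Fin m → ι → ℝ), Set.range z = S := by
    have := hS.fintype
    refine ⟨Fintype.card S, fun i => ((Fintype.equivFin S).symm i : ι → ℝ), ?_⟩
    ext x
    constructor
    · rintro ⟨i, rfl⟩
      exact ((Fintype.equivFin S).symm i).2
    · intro hx
      exact ⟨Fintype.equivFin S ⟨x, hx⟩, by simp⟩
  let ε := finSumFinEquiv (m := m) (n := 2)
  let A' : Fin m ⊕ Fin 2 → Fin m → ℝ :=
    Sum.elim (fun i j => if i = j then -1 else 0) ![fun _ => 1, fun _ => -1]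
  let b' : Fin m ⊕ Fin 2 → ℝ := Sum.elim (fun _ => 0) ![1, -1]
  let π : (Fin m → ℝ) →ₗ[ℝ] (ι → ℝ) := Fintype.linearCombination ℝ z
  have key : ∀ x : Fin m → ℝ, (Matrix.of (fun i => A' (ε.symm i))).mulVec x ≤ (fun i => b' (ε.symm i))
      ↔ x ∈ stdSimplex ℝ (Fin m) := by
    intro x
    rw [Pi.le_def, ← Equiv.forall_congr_right ε]
    simp only [Matrix.mulVec, dotProduct, Matrix.of_apply, Equiv.symm_apply_apply, Sum.forall,
      Fin.forall_fin_two, A', b', Sum.elim_inl, Sum.elim_inr, Matrix.cons_val_zero,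
      Matrix.cons_val_one, one_mul, neg_one_mul, ite_mul, zero_mul, Finset.sum_ite_eq,
      Finset.mem_univ, if_true, Finset.sum_neg_distrib, neg_le_neg_iff, neg_nonpos]
    constructor
    · rintro ⟨h1, h2, h3⟩
      exact ⟨h1, le_antisymm h2 h3⟩
    · rintro ⟨h1, h2⟩
      exact ⟨h1, h2.le, h2.ge⟩
  refine ⟨m + 2, m, Matrix.of (fun i => A' (ε.symm i)), fun i => b' (ε.symm i), π, ?_⟩
  have : {x | (Matrix.of (fun i => A' (ε.symm i))).mulVec x ≤ (fun i => b' (ε.symm i))}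
      = stdSimplex ℝ (Fin m) := Set.ext key
  rw [this, ← convexHull_basis_eq_stdSimplex, LinearMap.image_convexHull]
  congr 1
  rw [← hz, ← Set.range_comp]
  congr 1
  ext i j
  simp only [π, Fintype.linearCombination_apply, Function.comp_apply, ite_smul, one_smul, zero_smul,
    Finset.sum_ite_eq, Finset.mem_univ, if_true]

theorem xc_attained (n : ℕ) : ∃ (m : ℕ) (A : Matrix (Fin (xc (perfectMatchingPolytope n))) (Fin m) ℝ)
    (b : Fin (xc (perfectMatchingPolytope n)) → ℝ) (π : (Fin m → ℝ) →ₗ[ℝ] (KEdge n → ℝ)),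
      π '' {x | A.mulVec x ≤ b} = perfectMatchingPolytope n := by
  have hfin : {x | ∃ M : Finset (Sym2 (Fin n)), IsPerfectMatchingKm n M ∧ x = chi M}.Finite := by
    refine (Set.finite_range (chi (n := n))).subset ?_
    rintro _ ⟨M, -, rfl⟩
    exact ⟨M, rfl⟩
  obtain ⟨k, hk⟩ := xc_nonempty _ hfin
  rw [← polytope_eq] at hk
  exact Nat.sInf_mem (s := {k | ∃ (m : ℕ) (A : Matrix (Fin k) (Fin m) ℝ) (b : Fin k → ℝ)
      (π : (Fin m → ℝ) →ₗ[ℝ] (KEdge n → ℝ)),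
      π '' {x | A.mulVec x ≤ b} = perfectMatchingPolytope n}) ⟨k, hk⟩

section link
set_option linter.unusedSectionVars false
variable {L : Type} [Fintype L] [DecidableEq L]

/-- The partner of a vertex in the matching of the label involution `ρ`. -/
def partner (ρ : L → L) (v : L × Bool) : L × Bool :=
  if ρ v.1 = v.1 then (v.1, !v.2) else (ρ v.1, v.2)

theorem partner_invol (ρ : L → L) (hρ : Function.Involutive ρ) :
    Function.Involutive (partner ρ) := by
  rintro ⟨l, b⟩
  by_cases h : ρ l = l
  · simp [partner, h]
  · have h' : ¬ l = ρ l := fun h' => h h'.symm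
    simp [partner, h, h', hρ l]

theorem partner_ne (ρ : L → L) (v : L × Bool) : partner ρ v ≠ v := by
  obtain ⟨l, b⟩ := v
  by_cases h : ρ l = l
  · simp [partner, h]
  · simp [partner, h]

/-- The involution on `Fin n`. -/
def tau {n : ℕ} (e : L × Bool ≃ Fin n) (ρ : L → L) : Fin n → Fin n :=
  fun v => e (partner ρ (e.symm v))

theorem tau_invol {n : ℕ} (e : L × Bool ≃ Fin n) (ρ : L → L) (hρ : Function.Involutive ρ) :
    Function.Involutive (tau e ρ) := by
  intro v
  simp [tau, partner_invol ρ hρ (e.symm v)]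

theorem tau_ne {n : ℕ} (e : L × Bool ≃ Fin n) (ρ : L → L) (v : Fin n) : tau e ρ v ≠ v := by
  intro h
  apply partner_ne ρ (e.symm v)
  apply e.injective
  rw [Equiv.apply_symm_apply]
  exact h

/-- The vertex set of `u`. -/
noncomputable def vset {n : ℕ} (e : L × Bool ≃ Fin n) (u : L → Bool) : Finset (Fin n) :=
  (Finset.univ.filter (fun l => u l = true)).map
    ⟨fun l => e (l, false), fun a b h => by simpa using h⟩

theorem mem_vset {n : ℕ} (e : L × Bool ≃ Fin n) (u : L → Bool) (v : L × Bool) :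
    e v ∈ vset e u ↔ u v.1 = true ∧ v.2 = false := by
  obtain ⟨l, b⟩ := v
  simp only [vset, Finset.mem_map, Finset.mem_filter, Finset.mem_univ, true_and]
  constructor
  · rintro ⟨a, ha, h⟩
    have h' : (a, false) = (l, b) := e.injective h
    rw [Prod.mk.injEq] at h'
    obtain ⟨rfl, rfl⟩ := h'
    exact ⟨ha, rfl⟩
  · rintro ⟨ha, rfl⟩
    exact ⟨l, ha, rfl⟩

theorem vset_odd {n : ℕ} (e : L × Bool ≃ Fin n) (u : L → Bool)
    (hu : Odd (∑ l, if u l = true then 1 else 0)) : Odd (vset e u).card := by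
  rw [vset, Finset.card_map, Finset.card_filter]
  convert hu

theorem cut_eq_crn {n : ℕ} (e : L × Bool ≃ Fin n) (u : L → Bool) (ρ : L → L)
    (hρ : Function.Involutive ρ) :
    cutSum (vset e u) (chi (invMatch (tau e ρ))) = (crn u ρ : ℝ) := by
  rw [cutSum_inv _ (tau_invol e ρ hρ) (tau_ne e ρ)]
  congr 1
  unfold crn
  rw [← Finset.card_filter]
  symm
  refine Finset.card_bij (fun l _ => e (l, false)) ?_ ?_ ?_
  · intro l hl
    simp only [Finset.mem_filter, Finset.mem_univ, true_and] at hl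
    rw [Finset.mem_filter, mem_vset]
    refine ⟨⟨hl.1, rfl⟩, ?_⟩
    unfold tau
    rw [mem_vset, Equiv.symm_apply_apply]
    by_cases h : ρ l = l
    · simp [partner, h]
    · have := hl.2.resolve_left h
      simp [partner, h, this]
  · intro a _ b _ h
    simpa using h
  · intro v hv
    obtain ⟨⟨l, b⟩, rfl⟩ := e.surjective v
    rw [Finset.mem_filter, mem_vset] at hv
    obtain ⟨⟨h1, h2⟩, h3⟩ := hv
    simp only at h1 h2
    subst h2
    refine ⟨l, ?_, rfl⟩
    simp only [Finset.mem_filter, Finset.mem_univ, true_and]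
    refine ⟨h1, ?_⟩
    by_cases h : ρ l = l
    · exact Or.inl h
    · right
      unfold tau at h3
      rw [mem_vset, Equiv.symm_apply_apply] at h3
      simpa [partner, h] using h3

theorem crn_le (u : L → Bool) (ρ : L → L) : crn u ρ ≤ Fintype.card L := by
  unfold crn
  rw [← Finset.card_filter]
  exact Finset.card_le_univ _

theorem slack_factors {n : ℕ} (e : L × Bool ≃ Fin n) :
    ∃ (f : Fin (xc (perfectMatchingPolytope n) + 1) → (L → Bool) → ℝ)
      (g : Fin (xc (perfectMatchingPolytope n) + 1) → (L → L) → ℝ),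
      (∀ t u, 0 ≤ f t u) ∧ (∀ t ρ, 0 ≤ g t ρ) ∧
      (∀ t u ρ, f t u * g t ρ ≤ (Fintype.card L : ℝ)) ∧
      (∀ u ρ, OddSet u → Function.Involutive ρ →
        ∑ t, f t u * g t ρ = (crn u ρ : ℝ) - 1) := by
  classical
  obtain ⟨m, A, b, π, hπ⟩ := xc_attained n
  have hpm : ∀ ρ : L → L, Function.Involutive ρ →
      ∃ x, A.mulVec x ≤ b ∧ π x = chi (invMatch (tau e ρ)) := by
    intro ρ hρ
    have : chi (invMatch (tau e ρ)) ∈ perfectMatchingPolytope n := by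
      rw [polytope_eq]
      exact subset_convexHull ℝ _ ⟨_, invMatch_pm _ (tau_invol e ρ hρ) (tau_ne e ρ), rfl⟩
    rw [← hπ] at this
    exact this
  have hfk : ∀ u : L → Bool, OddSet u → ∃ (l : Fin (xc (perfectMatchingPolytope n)) → ℝ) (μ : ℝ),
      (∀ i, 0 ≤ l i) ∧ 0 ≤ μ ∧
      ∀ x, cutSum (vset e u) (π x) - 1 = ∑ i, l i * (b i - A.mulVec x i) + μ := by
    intro u hu
    obtain ⟨x0, hx0, -⟩ := hpm id (fun _ => rfl)
    refine farkas_affine A b ((cutLin (vset e u)).comp π) 1 ⟨x0, hx0⟩ ?_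
    intro x hx
    refine cutLin_ge (vset e u) (vset_odd e u hu) (π x) ?_
    rw [← hπ]
    exact ⟨x, hx, rfl⟩
  choose! X hX hXπ using hpm
  choose! l μ hl hμ hid using hfk
  let f : Fin (xc (perfectMatchingPolytope n) + 1) → (L → Bool) → ℝ :=
    fun t u => if OddSet u then Fin.snoc (α := fun _ => ℝ) (l u) (μ u) t else 0
  let g : Fin (xc (perfectMatchingPolytope n) + 1) → (L → L) → ℝ :=
    fun t ρ => if Function.Involutive ρ then
      Fin.snoc (α := fun _ => ℝ) (fun i => b i - A.mulVec (X ρ) i) 1 t else 0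
  have hf : ∀ t u, 0 ≤ f t u := by
    intro t u
    by_cases h : OddSet u
    · simp only [f, if_pos h]
      refine Fin.lastCases ?_ (fun i => ?_) t
      · rw [Fin.snoc_last]; exact hμ u h
      · rw [Fin.snoc_castSucc]; exact hl u h i
    · simp [f, if_neg h]
  have hg : ∀ t ρ, 0 ≤ g t ρ := by
    intro t ρ
    by_cases h : Function.Involutive ρ
    · simp only [g, if_pos h]
      refine Fin.lastCases ?_ (fun i => ?_) t
      · rw [Fin.snoc_last]; exact zero_le_one
      · rw [Fin.snoc_castSucc]; exact sub_nonneg.2 (hX ρ h i)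
    · simp [g, if_neg h]
  have hfac : ∀ u ρ, OddSet u → Function.Involutive ρ →
        ∑ t, f t u * g t ρ = (crn u ρ : ℝ) - 1 := by
    intro u ρ hu hρ
    rw [← cut_eq_crn e u ρ hρ, ← hXπ ρ hρ, hid u hu, Fin.sum_univ_castSucc]
    simp only [f, g, if_pos hu, if_pos hρ, Fin.snoc_last, Fin.snoc_castSucc, mul_one]
  refine ⟨f, g, hf, hg, ?_, hfac⟩
  intro t u ρ
  by_cases hu : OddSet u
  · by_cases hρ : Function.Involutive ρ
    · have h1 := Finset.single_le_sum (f := fun t => f t u * g t ρ)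
        (fun t _ => mul_nonneg (hf t u) (hg t ρ)) (Finset.mem_univ t)
      rw [hfac u ρ hu hρ] at h1
      have h2 : (crn u ρ : ℝ) ≤ Fintype.card L := by exact_mod_cast crn_le u ρ
      linarith
    · simp [g, if_neg hρ]
  · simp [f, if_neg hu]

end link

theorem xc_ineq (q r : ℕ) (n : ℕ) (hn : n = 2 * (4 * q + 5 + r)) :
    1 ≤ 4000 * ((xc (perfectMatchingPolytope n) : ℝ) + 1) * n * (9999 / 10000) ^ (q + 1) := by
  have hcard : Fintype.card (Lab (Option (Fin q × Bool)) r) = 4 * q + 5 + r := by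
    simp [Lab]; ring
  have e : Lab (Option (Fin q × Bool)) r × Bool ≃ Fin n := Fintype.equivFinOfCardEq (by
    rw [Fintype.card_prod, hcard, Fintype.card_bool, hn]; ring)
  obtain ⟨f, g, hf, hg, hD, hfac⟩ := slack_factors e
  have hmem : ∀ (b : Bool) (i : Option (Fin q × Bool)),
      i ∈ insert none ((Finset.univ : Finset (Fin q)).map
        ⟨fun i => some (i, b), fun x y h => by simpa using h⟩) ↔
      i = none ∨ ∃ j, some (j, b) = i := by
    intro b i
    simp only [Finset.mem_insert, Finset.mem_map, Finset.mem_univ, true_and]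
    exact Iff.rfl
  have hcd : ∀ b : Bool, (insert none ((Finset.univ : Finset (Fin q)).map
        ⟨fun i => some (i, b), fun x y h => by simpa using h⟩)).card = q + 1 := by
    intro b
    rw [Finset.card_insert_of_notMem (by simp), Finset.card_map, Finset.card_univ,
      Fintype.card_fin]
  have h := core_bound (K := Option (Fin q × Bool)) (r := r)
    (insert none ((Finset.univ : Finset (Fin q)).map
        ⟨fun i => some (i, true), fun x y h => by simpa using h⟩))
    (insert none ((Finset.univ : Finset (Fin q)).map
        ⟨fun i => some (i, false), fun x y h => by simpa using h⟩)) none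
    (Finset.mem_insert_self _ _) (Finset.mem_insert_self _ _)
    (by
      intro i hi hj
      rw [hmem] at hi hj
      rcases hi with hi | ⟨a, rfl⟩
      · exact hi
      · rcases hj with hj | ⟨c, hc⟩
        · exact hj
        · simp at hc) (q + 1) (hcd true) (hcd false) _ _ f g hf hg hD hfac
  refine h.trans ?_
  push_cast
  have : (Fintype.card (Lab (Option (Fin q × Bool)) r) : ℝ) ≤ n := by
    rw [hcard, hn]
    push_cast
    linarith [(Nat.cast_nonneg q : (0:ℝ) ≤ q), (Nat.cast_nonneg r : (0:ℝ) ≤ r)]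
  gcongr

/-- Elementary asymptotics. -/
theorem final_asymp : ∃ c : ℝ, 0 < c ∧ ∃ N : ℕ, ∀ n q : ℕ, N ≤ n → n ≤ 8 * (q + 1) + 8 →
    ∀ k : ℕ, 1 ≤ 4000 * ((k : ℝ) + 1) * n * (9999 / 10000) ^ (q + 1) →
      (2 : ℝ) ^ (c * n) ≤ (k : ℝ) := by
  -- write `9999/10000 = exp (-a)`, then `c log 2 = a/16`
  obtain ⟨a, ha⟩ : ∃ a, a = -Real.log (9999 / 10000) := ⟨_, rfl⟩
  have ha0 : 0 < a := by
    rw [ha, neg_pos]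
    exact Real.log_neg (by norm_num) (by norm_num)
  have hexp : (9999 / 10000 : ℝ) = Real.exp (-a) := by
    rw [ha, neg_neg, Real.exp_log (by norm_num)]
  have hl2 : 0 < Real.log 2 := Real.log_pos (by norm_num)
  have hlim : Filter.Tendsto (fun x : ℝ => Real.exp (a / 16 * x) / x ^ (1 : ℝ)) Filter.atTop Filter.atTop :=
    tendsto_exp_mul_div_rpow_atTop 1 (a / 16) (by positivity)
  have hev := (hlim.comp tendsto_natCast_atTop_atTop).eventually_ge_atTop (8000 * Real.exp a)
  obtain ⟨N, hN⟩ := Filter.eventually_atTop.1 hev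
  refine ⟨a / 16 / Real.log 2, by positivity, N + 1, ?_⟩
  intro n q hn hq k hk
  have h1 := hN n (by omega)
  have hn0 : (0:ℝ) < n := by
    have : 0 < n := by omega
    exact_mod_cast this
  simp only [Function.comp_apply, Real.rpow_one] at h1
  rw [le_div_iff₀ hn0] at h1
  rw [hexp, ← Real.exp_nat_mul] at hk
  have hq' : (n : ℝ) ≤ 8 * (q + 1) + 8 := by exact_mod_cast hq
  have h2 : Real.exp (((q + 1 : ℕ) : ℝ) * -a) ≤ Real.exp (a - a / 8 * n) := by
    apply Real.exp_le_exp.2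
    push_cast
    nlinarith
  have h3 : Real.exp (a - a / 8 * n) = Real.exp a / (Real.exp (a / 16 * n) * Real.exp (a / 16 * n)) := by
    rw [← Real.exp_add, ← Real.exp_sub]
    congr 1
    ring
  have h4 : (2 : ℝ) ^ (a / 16 / Real.log 2 * n) = Real.exp (a / 16 * n) := by
    rw [Real.rpow_def_of_pos (by norm_num)]
    congr 1
    field_simp
  rw [h4]
  set T := Real.exp (a / 16 * n) with hT
  have hT1 : 1 ≤ T := Real.one_le_exp (by positivity)
  have hk0 : (0:ℝ) ≤ k := Nat.cast_nonneg k
  have h5 : 1 ≤ 4000 * ((k : ℝ) + 1) * n * (Real.exp a / (T * T)) := by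
    refine hk.trans ?_
    rw [← h3]
    gcongr
  have h6 : T * T ≤ 4000 * ((k : ℝ) + 1) * n * Real.exp a := by
    rw [← mul_div_assoc, le_div_iff₀ (by positivity)] at h5
    linarith
  have h7 : T * T ≤ (k + 1) / 2 * T := by
    refine h6.trans ?_
    have := mul_le_mul_of_nonneg_left h1 (by positivity : (0:ℝ) ≤ (k + 1) / 2)
    linarith
  have h8 := le_of_mul_le_mul_right h7 (by positivity)
  linarith

theorem perfect_matching_polytope_xc_exponential :
    ∃ c : ℝ, 0 < c ∧ ∃ N : ℕ, ∀ n : ℕ, Even n → N ≤ n →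
      (2 : ℝ) ^ (c * n) ≤ (xc (perfectMatchingPolytope n) : ℝ) := by
  obtain ⟨c, hc, N, hN⟩ := final_asymp
  refine ⟨c, hc, N + 10, ?_⟩
  intro n hn hNn
  obtain ⟨h, rfl⟩ := hn
  refine hN (h + h) ((h - 5) / 4) (by omega) (by omega) _ ?_
  exact xc_ineq ((h - 5) / 4) ((h - 5) % 4) (h + h) (by omega)
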